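/- One-step tangent bound for the noisy power method. Assume Λ ≥ (E1 + Emax)/2. Let Ψ ∈ V be nonzero with c := |⟨Υ0, Ψ⟩| > 0, let Δ ∈ V, let γ be a nonzero complex scalar, and set Ψ' = γ ((Λ − H) Ψ + Δ). If (Λ − E0) · c > |⟨Υ0, Δ⟩|, then Ψ' ≠ 0, F(Υ0, Ψ') > 0, and tan θ(Υ0, Ψ') ≤ ((Λ − E1) · tan θ(Υ0, Ψ) + ‖Δ‖ / c) / ((Λ − E0) − |⟨Υ0, Δ⟩| / c). -/

import Mathlib

open scoped ComplexInnerProductSpace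

/-- Fidelity between two states `φ` and `ψ`:
`F(φ, ψ) = |⟨φ, ψ⟩|² / (‖φ‖² ‖ψ‖²)`. -/
noncomputable def fid {V : Type*} [NormedAddCommGroup V] [InnerProductSpace ℂ V]
    (φ ψ : V) : ℝ := ‖⟪φ, ψ⟫‖ ^ 2 / (‖φ‖ ^ 2 * ‖ψ‖ ^ 2)

/-- Tangent of the Fubini–Study angle: `tan θ(φ, ψ) = √((1 − F(φ, ψ)) / F(φ, ψ))`. -/
noncomputable def tanθ {V : Type*} [NormedAddCommGroup V] [InnerProductSpace ℂ V]
    (φ ψ : V) : ℝ := Real.sqrt ((1 - fid φ ψ) / fid φ ψ)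
/-- A symmetric operator whose quadratic form is bounded by `M` on an invariant subspace is
bounded in norm by `M` there. -/
theorem LinearMap.IsSymmetric.norm_apply_le_of_abs_re_inner_le
    {V : Type*} [NormedAddCommGroup V] [InnerProductSpace ℂ V]
    {A : V →ₗ[ℂ] V} (hA : A.IsSymmetric) {S : Submodule ℂ V} (hS : ∀ x ∈ S, A x ∈ S)
    {M : ℝ} (hM : 0 ≤ M) (hq : ∀ x ∈ S, |(⟪x, A x⟫).re| ≤ M * ‖x‖ ^ 2)
    {y : V} (hy : y ∈ S) : ‖A y‖ ≤ M * ‖y‖ := by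
  have polar (x : V) (hx : x ∈ S) :
      4 * (⟪x, A y⟫).re ≤ 2 * M * (‖x‖ ^ 2 + ‖y‖ ^ 2) := by
    have h_add := (abs_le.mp (hq (x + y) (S.add_mem hx hy))).2
    have h_sub := (abs_le.mp (hq (x - y) (S.sub_mem hx hy))).1
    have h_symm : (⟪y, A x⟫).re = (⟪x, A y⟫).re := by
      rw [← hA y x, ← inner_conj_symm, Complex.conj_re]
    have h_par := parallelogram_law_with_norm ℂ x y
    simp only [map_add, map_sub, inner_add_left, inner_add_right, inner_sub_left,
      inner_sub_right, Complex.add_re, Complex.sub_re] at h_add h_sub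
    have h_mul := congrArg (M * ·) h_par
    nlinarith
  have scaled (t : ℝ) :
      4 * (t * ‖A y‖ ^ 2) ≤ 2 * M * (t ^ 2 * ‖A y‖ ^ 2 + ‖y‖ ^ 2) := by
    have h := polar ((t : ℂ) • A y) (S.smul_mem _ (hS y hy))
    have h_self : (⟪A y, A y⟫).re = ‖A y‖ ^ 2 := inner_self_eq_norm_sq (𝕜 := ℂ) (A y)
    rwa [inner_smul_left, Complex.conj_ofReal, Complex.re_ofReal_mul, h_self, norm_smul,
      mul_pow, Complex.norm_real, Real.norm_eq_abs, sq_abs] at h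
  refine abs_le_of_sq_le_sq' ?_ (by positivity) |>.2
  rcases hM.eq_or_lt with rfl | hM
  · have := scaled 1
    nlinarith
  · have h := mul_le_mul_of_nonneg_left (scaled M⁻¹) hM.le
    field_simp at h
    nlinarith

/-- Pythagoras for the component of `ψ` orthogonal to a unit vector `u`. -/
theorem norm_sub_inner_smul_sq {V : Type*} [NormedAddCommGroup V] [InnerProductSpace ℂ V]
    {u : V} (hu : ‖u‖ = 1) (ψ : V) :
    ‖ψ - ⟪u, ψ⟫ • u‖ ^ 2 = ‖ψ‖ ^ 2 - ‖⟪u, ψ⟫‖ ^ 2 := by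
  have h_orth : ⟪ψ - ⟪u, ψ⟫ • u, ⟪u, ψ⟫ • u⟫ = 0 := by
    rw [inner_smul_right, inner_eq_zero_symm.mp (?_ : ⟪u, ψ - ⟪u, ψ⟫ • u⟫ = 0), mul_zero]
    simp [hu]
  have h := norm_add_sq_eq_norm_sq_add_norm_sq_of_inner_eq_zero _ _ h_orth
  rw [sub_add_cancel, norm_smul, hu, mul_one] at h
  linarith

theorem fid_pos {V : Type*} [NormedAddCommGroup V] [InnerProductSpace ℂ V]
    {φ ψ : V} (h : ⟪φ, ψ⟫ ≠ 0) : 0 < fid φ ψ := by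
  have hφ : φ ≠ 0 := by rintro rfl; simp at h
  have hψ : ψ ≠ 0 := by rintro rfl; simp at h
  unfold fid
  positivity

/-- The tangent is the ratio of the components of `ψ` orthogonal and parallel to `u`. -/
theorem tanθ_eq_norm_sub_div {V : Type*} [NormedAddCommGroup V] [InnerProductSpace ℂ V]
    {u ψ : V} (hu : ‖u‖ = 1) (h : ⟪u, ψ⟫ ≠ 0) :
    tanθ u ψ = ‖ψ - ⟪u, ψ⟫ • u‖ / ‖⟪u, ψ⟫‖ := by
  have hψ : ψ ≠ 0 := by rintro rfl; simp at h
  have h' : ‖⟪u, ψ⟫‖ ≠ 0 := norm_ne_zero_iff.mpr h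
  have h_ratio : (1 - fid u ψ) / fid u ψ = (‖ψ - ⟪u, ψ⟫ • u‖ / ‖⟪u, ψ⟫‖) ^ 2 := by
    rw [div_pow, norm_sub_inner_smul_sq hu, fid, hu]
    field_simp
  rw [tanθ, h_ratio, Real.sqrt_sq (by positivity)]

/-- **One-step tangent bound for the noisy power method.** -/
theorem one_step_tangent_bound
    {V : Type*} [NormedAddCommGroup V] [InnerProductSpace ℂ V] [FiniteDimensional ℂ V]
    (H : V →ₗ[ℂ] V) (hH : H.IsSymmetric)
    (Υ0 : V) (hΥ0 : ‖Υ0‖ = 1)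
    (E0 E1 Emax δ Λ : ℝ)
    (hgs : H Υ0 = (E0 : ℂ) • Υ0)
    (hE01 : E0 ≤ E1) (hE1max : E1 ≤ Emax)
    (hspec : ∀ ψ : V, ⟪Υ0, ψ⟫ = 0 →
      E1 * ‖ψ‖ ^ 2 ≤ (⟪ψ, H ψ⟫).re ∧ (⟪ψ, H ψ⟫).re ≤ Emax * ‖ψ‖ ^ 2)
    (hδ : δ = E1 - E0) (hδpos : 0 < δ)
    (hΛ : (E1 + Emax) / 2 ≤ Λ)
    (Ψ : V) (hΨ : Ψ ≠ 0)
    (c : ℝ) (hc : c = ‖⟪Υ0, Ψ⟫‖) (hcpos : 0 < c)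
    (Δ : V) (γ : ℂ) (hγ : γ ≠ 0)
    (Ψ' : V) (hΨ' : Ψ' = γ • (((Λ : ℂ) • Ψ - H Ψ) + Δ))
    (hdom : ‖⟪Υ0, Δ⟫‖ < (Λ - E0) * c) :
    Ψ' ≠ 0 ∧ 0 < fid Υ0 Ψ' ∧
    tanθ Υ0 Ψ' ≤ ((Λ - E1) * tanθ Υ0 Ψ + ‖Δ‖ / c) / ((Λ - E0) - ‖⟪Υ0, Δ⟫‖ / c) := by
  set a : ℂ := ⟪Υ0, Ψ⟫ with ha
  set d : ℂ := ⟪Υ0, Δ⟫ with hd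
  set p : V := Ψ - a • Υ0 with hp
  set q : V := Δ - d • Υ0 with hq
  let A : V →ₗ[ℂ] V := (Λ : ℂ) • LinearMap.id - H
  have hA_apply (x : V) : A x = (Λ : ℂ) • x - H x := rfl
  have hA : A.IsSymmetric := fun x y => by
    rw [hA_apply, hA_apply, inner_sub_left, inner_sub_right, inner_smul_left, inner_smul_right,
      Complex.conj_ofReal, hH x y]
  have hA_gs : A Υ0 = ((Λ - E0 : ℝ) : ℂ) • Υ0 := by
    rw [hA_apply, hgs, Complex.ofReal_sub, sub_smul]
  have h_inner_A (x : V) : ⟪Υ0, A x⟫ = ((Λ - E0 : ℝ) : ℂ) * ⟪Υ0, x⟫ := by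
    rw [← hA, hA_gs, inner_smul_left, Complex.conj_ofReal]
  have hp_orth : ⟪Υ0, p⟫ = 0 := by
    simp [hp, ha, hΥ0]
  have hAp : ‖A p‖ ≤ (Λ - E1) * ‖p‖ := by
    refine hA.norm_apply_le_of_abs_re_inner_le (S := (ℂ ∙ Υ0)ᗮ) (fun x hx => ?_) (by linarith)
      (fun x hx => ?_) (Submodule.mem_orthogonal_singleton_iff_inner_right.mpr hp_orth)
    · rw [Submodule.mem_orthogonal_singleton_iff_inner_right] at hx ⊢
      rw [h_inner_A, hx, mul_zero]
    · rw [Submodule.mem_orthogonal_singleton_iff_inner_right] at hx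
      obtain ⟨h_lo, h_hi⟩ := hspec x hx
      have h_self : (⟪x, x⟫).re = ‖x‖ ^ 2 := inner_self_eq_norm_sq (𝕜 := ℂ) x
      rw [hA_apply, inner_sub_right, inner_smul_right, Complex.sub_re, Complex.re_ofReal_mul,
        h_self, abs_le]
      constructor <;> nlinarith [sq_nonneg ‖x‖]
  have hq_norm : ‖q‖ ≤ ‖Δ‖ := by
    refine abs_le_of_sq_le_sq' ?_ (norm_nonneg _) |>.2
    rw [hq, hd, norm_sub_inner_smul_sq hΥ0]
    linarith [sq_nonneg ‖(⟪Υ0, Δ⟫ : ℂ)‖]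
  have hΨ'_eq : Ψ' = γ • (A Ψ + Δ) := hΨ'
  set b : ℂ := ((Λ - E0 : ℝ) : ℂ) * a + d with hb
  have h_inner : ⟪Υ0, Ψ'⟫ = γ * b := by
    rw [hΨ'_eq, inner_smul_right, inner_add_right, h_inner_A]
  have h_perp : Ψ' - ⟪Υ0, Ψ'⟫ • Υ0 = γ • (A p + q) := by
    rw [h_inner, hΨ'_eq, hp, hq, map_sub, map_smul, hA_gs, hb]
    module
  have hΛE0 : 0 < Λ - E0 := by linarith
  have hb_norm : (Λ - E0) * c - ‖d‖ ≤ ‖b‖ := by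
    have h := norm_sub_le_norm_add (((Λ - E0 : ℝ) : ℂ) * a) d
    rwa [norm_mul, Complex.norm_real, Real.norm_of_nonneg hΛE0.le, ← hc] at h
  have hb_lower : 0 < (Λ - E0) * c - ‖d‖ := by linarith
  have hb_pos : 0 < ‖b‖ := hb_lower.trans_le hb_norm
  have ha_ne : a ≠ 0 := norm_pos_iff.mp (hc ▸ hcpos)
  have h_ne : ⟪Υ0, Ψ'⟫ ≠ 0 := h_inner ▸ mul_ne_zero hγ (norm_pos_iff.mp hb_pos)
  refine ⟨fun h => h_ne (by rw [h, inner_zero_right]), fid_pos h_ne, ?_⟩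
  have hγ_norm : ‖γ‖ ≠ 0 := norm_ne_zero_iff.mpr hγ
  rw [tanθ_eq_norm_sub_div hΥ0 h_ne, tanθ_eq_norm_sub_div hΥ0 ha_ne, h_perp, h_inner,
    norm_smul, norm_mul, mul_div_mul_left _ _ hγ_norm, ← ha, ← hp, ← hc]
  calc ‖A p + q‖ / ‖b‖
      ≤ ((Λ - E1) * ‖p‖ + ‖Δ‖) / ((Λ - E0) * c - ‖d‖) := by
        have h_num := (norm_add_le (A p) q).trans (add_le_add hAp hq_norm)
        exact div_le_div₀ ((norm_nonneg _).trans h_num) h_num hb_lower hb_norm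
    _ = ((Λ - E1) * (‖p‖ / c) + ‖Δ‖ / c) / ((Λ - E0) - ‖d‖ / c) := by
        rw [← mul_div_assoc, ← add_div, sub_div' hcpos.ne',
          div_div_div_cancel_right₀ hcpos.ne']
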